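/- arXiv:1307.7770 — 2 statements merged into one kernel-verified Lean document; each statement's English description precedes it below -/
import Mathlib

section
/- Let 𝒳 and 𝒴 be finite alphabets, P_X a source distribution on 𝒳 with full support, and P_{XY} = P_X P_{Y|X} a joint distribution belonging to 𝒜 = {P_{XY} : P_{X|Y}(x|y) > 0 for all (x,y) ∈ 𝒳×𝒴}. Then for any good sequence of (n,R_n) coordination codes for P_{Y|X}, it holds that lim_{n→∞} (1/n) D(P_{X^nY^n} ‖ Q_{X^nY^n}) = 0, where P_{X^nY^n} is the code-induced joint distribution and Q_{X^nY^n} is the approximating distribution given by a uniformly random codeword passed through the backward memoryless channel P_{X|Y}. -/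
open scoped BigOperators ENNReal Classical
open Filter

section InformationDefs

variable {α X Y : Type*}

/-- A probability mass function on a finite alphabet. -/
def IsPMF [Fintype α] (P : α → ℝ) : Prop :=
  (∀ a, 0 ≤ P a) ∧ ∑ a, P a = 1

/-- Variational distance `‖P − Q‖ = sup_A |P(A) − Q(A)|` on a finite alphabet. -/
noncomputable def tvDist [Fintype α] (P Q : α → ℝ) : ℝ :=
  Finset.univ.powerset.sup' ⟨∅, Finset.empty_mem_powerset _⟩
    fun A => |∑ a ∈ A, P a - ∑ a ∈ A, Q a|

/-- Relative entropy `D(P‖Q) = ∑ P log(P/Q)` on a finite alphabet, infinite when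
`P` is not absolutely continuous with respect to `Q`. -/
noncomputable def relEnt [Fintype α] (P Q : α → ℝ) : ℝ≥0∞ :=
  if ∀ a, Q a = 0 → P a = 0 then
    ENNReal.ofReal (∑ a, P a * Real.log (P a / Q a))
  else ⊤

/-- Shannon entropy on a finite alphabet. -/
noncomputable def entropy [Fintype α] (P : α → ℝ) : ℝ :=
  -∑ a, P a * Real.log (P a)

/-- First (X-) marginal of a joint distribution. -/
noncomputable def margX [Fintype Y] (P : X × Y → ℝ) : X → ℝ :=
  fun x => ∑ y, P (x, y)

/-- Second (Y-) marginal of a joint distribution. -/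
noncomputable def margY [Fintype X] (P : X × Y → ℝ) : Y → ℝ :=
  fun y => ∑ x, P (x, y)

/-- Backward conditional distribution `P_{X|Y}(x|y) = P(x,y)/P_Y(y)`. -/
noncomputable def condXY [Fintype X] (P : X × Y → ℝ) : X → Y → ℝ :=
  fun x y => P (x, y) / margY P y

/-- Forward conditional distribution `P_{Y|X}(y|x) = P(x,y)/P_X(x)`. -/
noncomputable def condYX [Fintype Y] (P : X × Y → ℝ) : Y → X → ℝ :=
  fun y x => P (x, y) / margX P x

/-- Mutual information `I(X;Y)` of a joint distribution on a finite product alphabet. -/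
noncomputable def mutualInfo [Fintype X] [Fintype Y] (P : X × Y → ℝ) : ℝ :=
  ∑ x, ∑ y, P (x, y) * Real.log (P (x, y) / (margX P x * margY P y))

/-- A block code of length `n`: an encoder into `{1,…,M}` and a decoder. -/
structure Code (X Y : Type*) (n : ℕ) where
  M : ℕ
  hM : 0 < M
  enc : (Fin n → X) → Fin M
  dec : Fin M → Fin n → Y

/-- Rate `R_n = (1/n) log M` of a code. -/
noncomputable def Code.rate {X Y : Type*} {n : ℕ} (c : Code X Y n) : ℝ :=
  Real.log c.M / n

/-- The reconstruction sequence `Yⁿ = g_n(f_n(xⁿ))` produced by a code. -/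
def Code.out {X Y : Type*} {n : ℕ} (c : Code X Y n) (xs : Fin n → X) : Fin n → Y :=
  c.dec (c.enc xs)

/-- The i.i.d. (memoryless) source distribution on `n`-blocks. -/
noncomputable def iid (PX : X → ℝ) (n : ℕ) : (Fin n → X) → ℝ :=
  fun xs => ∏ i, PX (xs i)

/-- The code-induced joint distribution
`P_{XⁿYⁿ}(xⁿ,yⁿ) = ∏ P_X(x_i) · 1{yⁿ = g_n(f_n(xⁿ))}`. -/
noncomputable def inducedJoint [DecidableEq Y] (PX : X → ℝ) {n : ℕ} (c : Code X Y n) :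
    (Fin n → X) × (Fin n → Y) → ℝ :=
  fun p => (∏ i, PX (p.1 i)) * (if p.2 = c.out p.1 then 1 else 0)

/-- The approximating joint distribution
`Q_{XⁿYⁿ}(xⁿ,yⁿ) = (|g_n⁻¹(yⁿ)|/M) · ∏ P_{X|Y}(x_i|y_i)`:
a uniformly chosen codeword passed through the backward memoryless channel. -/
noncomputable def approxJoint [Fintype X] [DecidableEq Y] (PXY : X × Y → ℝ) {n : ℕ}
    (c : Code X Y n) : (Fin n → X) × (Fin n → Y) → ℝ :=
  fun p => (((Finset.univ.filter fun m => c.dec m = p.2).card : ℝ) / c.M) *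
    ∏ i, condXY PXY (p.1 i) (p.2 i)

/-- The uniform distribution over the codebook, `Q_{Yⁿ}(yⁿ) = |g_n⁻¹(yⁿ)|/M`. -/
noncomputable def codebookUniform [DecidableEq Y] {n : ℕ} (c : Code X Y n) :
    (Fin n → Y) → ℝ :=
  fun ys => ((Finset.univ.filter fun m => c.dec m = ys).card : ℝ) / c.M

/-- The empirical (joint type) distribution of a pair of sequences. -/
noncomputable def empDist [DecidableEq X] [DecidableEq Y] {n : ℕ}
    (xs : Fin n → X) (ys : Fin n → Y) : X × Y → ℝ :=
  fun p => ((Finset.univ.filter fun i => xs i = p.1 ∧ ys i = p.2).card : ℝ) / n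

/-- `‖T_{XⁿYⁿ} − P_{XY}‖ → 0` in probability under the i.i.d. source. -/
def TVInProb [Fintype X] [Fintype Y] [DecidableEq X] [DecidableEq Y]
    (PX : X → ℝ) (PXY : X × Y → ℝ) (c : ∀ n, Code X Y n) : Prop :=
  ∀ ε : ℝ, 0 < ε →
    Tendsto (fun n => ∑ xs : Fin n → X,
        if ε < tvDist (empDist xs ((c n).out xs)) PXY then iid PX n xs else 0)
      atTop (nhds 0)

/-- A good sequence of coordination codes for `P_{Y|X}` (specified via the joint `PXY`):
the rates converge to `I(X;Y)` and the empirical distribution converges to `PXY`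
in variational distance, in probability. -/
def GoodCoord [Fintype X] [Fintype Y] [DecidableEq X] [DecidableEq Y]
    (PX : X → ℝ) (PXY : X × Y → ℝ) (c : ∀ n, Code X Y n) : Prop :=
  Tendsto (fun n => (c n).rate) atTop (nhds (mutualInfo PXY)) ∧ TVInProb PX PXY c

end InformationDefs
section CoordinationLemmas

variable {α X Y : Type*}

lemma abs_sub_le_tvDist [Fintype α] (P Q : α → ℝ) (a : α) : |P a - Q a| ≤ tvDist P Q := by
  have h := Finset.le_sup' (fun A : Finset α => |∑ a ∈ A, P a - ∑ a ∈ A, Q a|)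
    (show {a} ∈ Finset.univ.powerset by simp)
  simpa [tvDist] using h

lemma empDist_nonneg [DecidableEq X] [DecidableEq Y] {n : ℕ}
    (xs : Fin n → X) (ys : Fin n → Y) (p : X × Y) : 0 ≤ empDist xs ys p := by
  unfold empDist; positivity

lemma empDist_le_one [DecidableEq X] [DecidableEq Y] {n : ℕ}
    (xs : Fin n → X) (ys : Fin n → Y) (p : X × Y) : empDist xs ys p ≤ 1 := by
  unfold empDist
  refine div_le_one_of_le₀ ?_ (Nat.cast_nonneg n)
  exact_mod_cast (Finset.card_filter_le _ _).trans (by simp)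

lemma sum_empDist_mul [Fintype X] [Fintype Y] [DecidableEq X] [DecidableEq Y] {n : ℕ}
    (xs : Fin n → X) (ys : Fin n → Y) (φ : X × Y → ℝ) :
    ∑ p, empDist xs ys p * φ p = (∑ i, φ (xs i, ys i)) / n := by
  have h (p : X × Y) : empDist xs ys p * φ p =
      (∑ i, if (xs i, ys i) = p then φ p else 0) / n := by
    rw [← Finset.sum_filter, Finset.sum_const, nsmul_eq_mul]
    simp only [empDist, Prod.ext_iff]
    ring
  simp_rw [h]
  rw [← Finset.sum_div, Finset.sum_comm]
  simp

lemma abs_sum_sub_mul_le_tvDist [Fintype α] (T P φ : α → ℝ) :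
    |∑ p, (T p - P p) * φ p| ≤ tvDist T P * ∑ p, |φ p| := by
  refine (Finset.abs_sum_le_sum_abs _ _).trans ?_
  rw [Finset.mul_sum]
  refine Finset.sum_le_sum fun p _ => ?_
  rw [abs_mul]
  gcongr
  exact abs_sub_le_tvDist T P p

lemma abs_sum_empDist_sub_mul_le [Fintype X] [Fintype Y] [DecidableEq X] [DecidableEq Y] {n : ℕ}
    (xs : Fin n → X) (ys : Fin n → Y) (P φ : X × Y → ℝ) :
    |∑ p, (empDist xs ys p - P p) * φ p| ≤ ∑ p, (1 + |P p|) * |φ p| := by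
  refine (Finset.abs_sum_le_sum_abs _ _).trans (Finset.sum_le_sum fun p _ => ?_)
  rw [abs_mul]
  gcongr
  refine (abs_sub _ _).trans ?_
  gcongr
  rw [abs_of_nonneg (empDist_nonneg xs ys p)]
  exact empDist_le_one xs ys p

lemma iid_nonneg {PX : X → ℝ} (h : ∀ x, 0 ≤ PX x) {n : ℕ} (xs : Fin n → X) :
    0 ≤ iid PX n xs :=
  Finset.prod_nonneg fun i _ => h (xs i)

lemma sum_iid [Fintype X] {PX : X → ℝ} (h : ∑ x, PX x = 1) (n : ℕ) :
    ∑ xs, iid PX n xs = 1 := by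
  have := Finset.prod_univ_sum (fun _ : Fin n => (Finset.univ : Finset X)) (fun _ x => PX x)
  simpa [iid, h] using this.symm

/-- Empirical averages of any function converge in mean when the empirical distribution converges
in probability. -/
lemma TVInProb.tendsto_mean_abs [Fintype X] [Fintype Y] [DecidableEq X] [DecidableEq Y]
    {PX : X → ℝ} (hPX : IsPMF PX) {PXY : X × Y → ℝ} {c : ∀ n, Code X Y n}
    (h : TVInProb PX PXY c) (φ : X × Y → ℝ) :
    Tendsto (fun n => ∑ xs, iid PX n xs *
      |∑ p, (empDist xs ((c n).out xs) p - PXY p) * φ p|) atTop (nhds 0) := by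
  set D := ∑ p, |φ p| with hD
  set C := ∑ p, (1 + |PXY p|) * |φ p| with hC
  have hD0 : 0 ≤ D := by positivity
  have hC0 : 0 ≤ C := by positivity
  have bound (ε : ℝ) (hε : 0 < ε) (n : ℕ) :
      ∑ xs, iid PX n xs * |∑ p, (empDist xs ((c n).out xs) p - PXY p) * φ p| ≤
        ε * D + C * ∑ xs : Fin n → X,
          if ε < tvDist (empDist xs ((c n).out xs)) PXY then iid PX n xs else 0 := by
    calc _ ≤ ∑ xs, (iid PX n xs * (ε * D) + C *
          if ε < tvDist (empDist xs ((c n).out xs)) PXY then iid PX n xs else 0) := by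
          refine Finset.sum_le_sum fun xs _ => ?_
          have h0 := iid_nonneg hPX.1 xs
          split_ifs with ht
          · have := mul_le_mul_of_nonneg_left
              (abs_sum_empDist_sub_mul_le xs ((c n).out xs) PXY φ) h0
            have : 0 ≤ iid PX n xs * (ε * D) := by positivity
            linarith
          · have h1 := abs_sum_sub_mul_le_tvDist (empDist xs ((c n).out xs)) PXY φ
            have h2 := h1.trans (mul_le_mul_of_nonneg_right (not_lt.mp ht) hD0)
            simpa using mul_le_mul_of_nonneg_left h2 h0
      _ = _ := by
          rw [Finset.sum_add_distrib, ← Finset.sum_mul, ← Finset.mul_sum, sum_iid hPX.2, one_mul]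
  rw [Metric.tendsto_atTop']
  intro δ hδ
  have hε : 0 < δ / (2 * (D + 1)) := by positivity
  have hlim := (h _ hε).const_mul C
  rw [mul_zero] at hlim
  obtain ⟨N, hN⟩ := eventually_atTop.mp (hlim.eventually_lt_const (half_pos hδ))
  refine ⟨N, fun n hn => ?_⟩
  have hnn : 0 ≤ ∑ xs, iid PX n xs * |∑ p, (empDist xs ((c n).out xs) p - PXY p) * φ p| :=
    Finset.sum_nonneg fun xs _ => mul_nonneg (iid_nonneg hPX.1 xs) (abs_nonneg _)
  rw [Real.dist_0_eq_abs, abs_of_nonneg hnn]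
  have hb := bound _ hε n
  have hn' := hN n hn.le
  have hmul : δ / (2 * (D + 1)) * D ≤ δ / 2 := by
    rw [div_mul_eq_mul_div, div_le_div_iff₀ (by positivity) two_pos]
    nlinarith
  linarith

lemma approxJoint_out_ge [Fintype X] [DecidableEq Y] {PXY : X × Y → ℝ}
    (hA : ∀ x y, 0 < condXY PXY x y) {n : ℕ} (c : Code X Y n) (xs : Fin n → X) :
    1 / (c.M : ℝ) * ∏ i, condXY PXY (xs i) (c.out xs i) ≤ approxJoint PXY c (xs, c.out xs) := by
  have hprod : 0 ≤ ∏ i, condXY PXY (xs i) (c.out xs i) :=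
    Finset.prod_nonneg fun i _ => (hA _ _).le
  have hcard : 1 ≤ (Finset.univ.filter fun m => c.dec m = c.out xs).card :=
    Finset.card_pos.mpr ⟨c.enc xs, Finset.mem_filter.mpr ⟨Finset.mem_univ _, rfl⟩⟩
  unfold approxJoint
  gcongr
  exact_mod_cast hcard

/-- The relative entropy is at most `log M` plus the mean of the log-ratio of the source to the
backward channel. -/
lemma relEnt_inducedJoint_le [Fintype X] [Fintype Y] [DecidableEq Y]
    {PX : X → ℝ} (hPX : IsPMF PX) (hPXfull : ∀ x, 0 < PX x) {PXY : X × Y → ℝ}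
    (hA : ∀ x y, 0 < condXY PXY x y) {n : ℕ} (c : Code X Y n) :
    relEnt (inducedJoint PX c) (approxJoint PXY c) ≤ ENNReal.ofReal
      (Real.log c.M + ∑ xs, iid PX n xs *
        ∑ i, Real.log (PX (xs i) / condXY PXY (xs i) (c.out xs i))) := by
  have hM : (0 : ℝ) < c.M := by exact_mod_cast c.hM
  have hprod (xs : Fin n → X) : 0 < ∏ i, condXY PXY (xs i) (c.out xs i) :=
    Finset.prod_pos fun i _ => hA _ _
  have hpos (xs : Fin n → X) : 0 < approxJoint PXY c (xs, c.out xs) :=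
    (mul_pos (one_div_pos.mpr hM) (hprod xs)).trans_le (approxJoint_out_ge hA c xs)
  have hac : ∀ a, approxJoint PXY c a = 0 → inducedJoint PX c a = 0 := by
    rintro ⟨xs, ys⟩ h0
    by_cases hy : ys = c.out xs
    · subst hy
      exact absurd h0 (hpos xs).ne'
    · simp [inducedJoint, hy]
  rw [relEnt, if_pos hac]
  refine ENNReal.ofReal_le_ofReal ?_
  have hlog : Real.log c.M = ∑ xs, iid PX n xs * Real.log c.M := by
    rw [← Finset.sum_mul, sum_iid hPX.2, one_mul]
  rw [hlog, ← Finset.sum_add_distrib, Fintype.sum_prod_type]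
  refine Finset.sum_le_sum fun xs _ => ?_
  have hiid : 0 < iid PX n xs := Finset.prod_pos fun i _ => hPXfull _
  rw [Finset.sum_eq_single (c.out xs) (fun ys _ hy => by simp [inducedJoint, hy]) (by simp),
    ← mul_add]
  have hP : inducedJoint PX c (xs, c.out xs) = iid PX n xs := by simp [inducedJoint, iid]
  rw [hP]
  refine mul_le_mul_of_nonneg_left ?_ hiid.le
  rw [← Real.log_prod fun i _ => (div_pos (hPXfull _) (hA _ _)).ne', Finset.prod_div_distrib,
    show ∏ i, PX (xs i) = iid PX n xs from rfl,
    ← Real.log_mul hM.ne' (div_pos hiid (hprod xs)).ne']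
  refine Real.log_le_log (div_pos hiid (hpos xs)) ?_
  calc _ ≤ iid PX n xs / (1 / (c.M : ℝ) * ∏ i, condXY PXY (xs i) (c.out xs i)) := by
        have := hprod xs
        gcongr
        exact approxJoint_out_ge hA c xs
    _ = _ := by
        have := (hprod xs).ne'
        simp only [iid]
        field_simp

lemma sum_mul_log_div_condXY [Fintype X] [Fintype Y] {PX : X → ℝ} {PXY : X × Y → ℝ}
    (hmarg : margX PXY = PX) :
    ∑ p, PXY p * Real.log (PX p.1 / condXY PXY p.1 p.2) = -mutualInfo PXY := by
  rw [mutualInfo, Fintype.sum_prod_type]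
  simp_rw [← Finset.sum_neg_distrib]
  refine Finset.sum_congr rfl fun x _ => Finset.sum_congr rfl fun y _ => ?_
  rw [← mul_neg, ← Real.log_inv, inv_div, hmarg, condXY, div_div_eq_mul_div]

end CoordinationLemmas

/-- **Theorem 2 (first part).** If `P_{XY} ∈ 𝒜` (all backward channel probabilities
positive), then for any good sequence of coordination codes for `P_{Y|X}`, the
normalized relative entropy between the code-induced joint distribution and the
approximating (uniform codeword through backward dmc) distribution vanishes. -/
theorem good_coordination_codes_backward_dmc
    {X Y : Type*} [Fintype X] [Fintype Y] [DecidableEq X] [DecidableEq Y]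
    (PX : X → ℝ) (hPX : IsPMF PX) (hPXfull : ∀ x, 0 < PX x)
    (W : X → Y → ℝ) (hW : ∀ x, IsPMF (W x))
    (PXY : X × Y → ℝ) (hPXY : ∀ x y, PXY (x, y) = PX x * W x y)
    (hA : ∀ x y, 0 < condXY PXY x y)
    (c : ∀ n, Code X Y n) (hgood : GoodCoord PX PXY c) :
    Tendsto
      (fun n => relEnt (inducedJoint PX (c n)) (approxJoint PXY (c n)) / (n : ℝ≥0∞))
      atTop (nhds 0) := by
  obtain ⟨hrate, htv⟩ := hgood
  have hmarg : margX PXY = PX := by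
    funext x
    simp [margX, hPXY, ← Finset.mul_sum, (hW x).2]
  set φ : X × Y → ℝ := fun p => Real.log (PX p.1 / condXY PXY p.1 p.2) with hφ
  have hlim := (hrate.sub_const (mutualInfo PXY)).add (htv.tendsto_mean_abs hPX φ)
  rw [sub_self, add_zero] at hlim
  have hlim' := ENNReal.tendsto_ofReal hlim
  rw [ENNReal.ofReal_zero] at hlim'
  refine tendsto_of_tendsto_of_tendsto_of_le_of_le' tendsto_const_nhds hlim'
    (Eventually.of_forall fun _ => zero_le) ?_
  filter_upwards [eventually_gt_atTop 0] with n hn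
  have hn' : (0 : ℝ) < n := by exact_mod_cast hn
  rw [← ENNReal.ofReal_natCast n]
  refine (ENNReal.div_le_div_right (relEnt_inducedJoint_le hPX hPXfull hA (c n)) _).trans ?_
  rw [← ENNReal.ofReal_div_of_pos hn']
  refine ENNReal.ofReal_le_ofReal ?_
  have hmean : (∑ xs, iid PX n xs * ∑ i, φ (xs i, (c n).out xs i)) / n ≤
      -mutualInfo PXY + ∑ xs, iid PX n xs *
        |∑ p, (empDist xs ((c n).out xs) p - PXY p) * φ p| := by
    have hI : -mutualInfo PXY = ∑ xs, iid PX n xs * -mutualInfo PXY := by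
      rw [← Finset.sum_mul, sum_iid hPX.2, one_mul]
    rw [hI, ← Finset.sum_add_distrib, Finset.sum_div]
    refine Finset.sum_le_sum fun xs _ => ?_
    rw [← mul_add, mul_div_assoc]
    refine mul_le_mul_of_nonneg_left ?_ (iid_nonneg hPX.1 xs)
    rw [← sum_empDist_mul, ← sum_mul_log_div_condXY hmarg, ← sub_le_iff_le_add',
      ← Finset.sum_sub_distrib]
    simp_rw [sub_mul]
    exact le_abs_self _
  rw [add_div, Code.rate]
  linarith
end

section
/- Let 𝒳 and 𝒴 be finite alphabets, P_X a source distribution on 𝒳 with full support, and P_{XY} = P_X P_{Y|X} a joint distribution NOT belonging to 𝒜 = {P_{XY} : P_{X|Y}(x|y) > 0 for all (x,y)}, excluding the single pathological case P_{XY}(x,y) = (1/|𝒳|)·1{x=y}. Then there exists a good sequence of (n,R_n) coordination codes for P_{Y|X} such that lim_{n→∞} (1/n) D(P_{X^nY^n} ‖ Q_{X^nY^n}) = ∞, where P_{X^nY^n} is the code-induced joint distribution and Q_{X^nY^n} is the approximating distribution. -/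
open scoped BigOperators ENNReal Classical
open Filter

section CoveringCodes

variable {α β X Y : Type*}

theorem IsPMF.le_one [Fintype α] {P : α → ℝ} (hP : IsPMF P) (a : α) : P a ≤ 1 := by
  rw [← hP.2]
  exact Finset.single_le_sum (fun b _ => hP.1 b) (Finset.mem_univ a)

theorem IsPMF.nonempty [Fintype α] {P : α → ℝ} (hP : IsPMF P) : Nonempty α := by
  by_contra h
  rw [not_nonempty_iff] at h
  simpa using hP.2

theorem IsPMF.iid [Fintype α] {P : α → ℝ} (hP : IsPMF P) (n : ℕ) : IsPMF (iid P n) :=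
  ⟨fun _ => Finset.prod_nonneg fun _ _ => hP.1 _, by
    have := Fintype.sum_pow P n
    rw [hP.2, one_pow] at this
    exact this.symm⟩

theorem one_sub_pow_le_add_exp {a b p : ℝ} (hb0 : 0 ≤ b) (hb1 : b ≤ 1)
    (hp1 : p ≤ 1) (hab : a * b ≤ p) (M : ℕ) :
    (1 - p) ^ M ≤ (1 - b) + Real.exp (-(a * M)) := by
  have h1 : (1 - p) ^ M ≤ Real.exp (-(a * b)) ^ M := by
    apply pow_le_pow_left₀ (by linarith)
    have := Real.add_one_le_exp (-(a * b))
    linarith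
  have h2 := convexOn_exp.2 (Set.mem_univ (-(a * M))) (Set.mem_univ (0 : ℝ)) hb0
    (sub_nonneg.2 hb1) (by ring)
  simp only [smul_eq_mul, mul_zero, add_zero, Real.exp_zero, mul_one] at h2
  have h3 : Real.exp (-(a * b)) ^ M = Real.exp (b * -(a * M)) := by
    rw [← Real.exp_nat_mul]
    ring_nf
  have h4 : b * Real.exp (-(a * M)) ≤ Real.exp (-(a * M)) :=
    mul_le_of_le_one_left (Real.exp_pos _).le hb1
  linarith

/-- One-shot covering lemma: some codebook of size `M` fails to cover a random `x` with
probability at most `P(Aᶜ) + exp (-a M)`, where `a` bounds `q / V` from below on `A`. -/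
theorem exists_codebook_covering [Fintype α] [Fintype β] {p : α → ℝ} (hp : IsPMF p)
    {V : α → β → ℝ} (hV : ∀ x, IsPMF (V x)) {q : β → ℝ} (hq : IsPMF q)
    (A : α → β → Prop) {a : ℝ} (hA : ∀ x y, A x y → a * V x y ≤ q y) (M : ℕ) :
    ∃ B : Fin M → β, ∑ x, p x * (if ∃ m, A x (B m) then 0 else 1) ≤
      (∑ x, p x * ∑ y, V x y * (if A x y then 0 else 1)) + Real.exp (-(a * M)) := by
  have hind : ∀ (x : α) (B : Fin M → β), (if ∃ m, A x (B m) then (0 : ℝ) else 1) =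
      ∏ m, if A x (B m) then 0 else 1 := by
    intro x B
    by_cases h : ∃ m, A x (B m)
    · obtain ⟨m, hm⟩ := h
      rw [if_pos ⟨m, hm⟩, Finset.prod_eq_zero (Finset.mem_univ m)]
      simp [hm]
    · rw [if_neg h]
      push Not at h
      simp [h]
  have havg : ∑ B : Fin M → β, iid q M B * ∑ x, p x * (if ∃ m, A x (B m) then 0 else 1) =
      ∑ x, p x * (∑ y, q y * (if A x y then 0 else 1)) ^ M := by
    simp_rw [Fintype.sum_pow, Finset.mul_sum, hind]
    rw [Finset.sum_comm]
    refine Finset.sum_congr rfl fun x _ => Finset.sum_congr rfl fun B _ => ?_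
    rw [Finset.prod_mul_distrib, iid]
    ring
  have hcompl : ∀ (r : β → ℝ), IsPMF r → ∀ x, ∑ y, r y * (if A x y then 0 else 1) =
      1 - ∑ y, r y * (if A x y then 1 else 0) := by
    intro r hr x
    rw [eq_sub_iff_add_eq, ← Finset.sum_add_distrib]
    refine Eq.trans ?_ hr.2
    refine Finset.sum_congr rfl fun y _ => ?_
    split_ifs <;> simp
  have hmem : ∀ (r : β → ℝ), IsPMF r → ∀ x, 0 ≤ ∑ y, r y * (if A x y then 1 else 0) ∧
      ∑ y, r y * (if A x y then 1 else 0) ≤ 1 := by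
    intro r hr x
    refine ⟨Finset.sum_nonneg fun y _ => mul_nonneg (hr.1 y) (by split_ifs <;> simp), ?_⟩
    refine le_trans ?_ hr.2.le
    refine Finset.sum_le_sum fun y _ => mul_le_of_le_one_right (hr.1 y) ?_
    split_ifs <;> simp
  have hbound : ∑ x, p x * (∑ y, q y * (if A x y then 0 else 1)) ^ M ≤
      (∑ x, p x * ∑ y, V x y * (if A x y then 0 else 1)) + Real.exp (-(a * M)) := by
    have : Real.exp (-(a * M)) = ∑ x, p x * Real.exp (-(a * M)) := by
      rw [← Finset.sum_mul, hp.2, one_mul]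
    rw [this, ← Finset.sum_add_distrib]
    refine Finset.sum_le_sum fun x _ => ?_
    rw [← mul_add, hcompl q hq, hcompl _ (hV x)]
    refine mul_le_mul_of_nonneg_left ?_ (hp.1 x)
    refine one_sub_pow_le_add_exp (hmem _ (hV x) x).1 (hmem _ (hV x) x).2 (hmem q hq x).2 ?_ M
    rw [Finset.mul_sum]
    refine Finset.sum_le_sum fun y _ => ?_
    split_ifs with h
    · simpa using hA x y h
    · simp
  by_contra! hcon
  have hlt : ∑ B : Fin M → β, iid q M B *
      ((∑ x, p x * ∑ y, V x y * (if A x y then 0 else 1)) + Real.exp (-(a * M))) <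
      ∑ B : Fin M → β, iid q M B * ∑ x, p x * (if ∃ m, A x (B m) then 0 else 1) := by
    obtain ⟨B₀, -, hB₀⟩ := Finset.exists_ne_zero_of_sum_ne_zero
      (by rw [(hq.iid M).2]; exact one_ne_zero :
        ∑ B : Fin M → β, iid q M B ≠ 0)
    exact Finset.sum_lt_sum
      (fun B _ => mul_le_mul_of_nonneg_left (hcon B).le ((hq.iid M).1 B))
      ⟨B₀, Finset.mem_univ _, mul_lt_mul_of_pos_left (hcon B₀)
        (lt_of_le_of_ne ((hq.iid M).1 B₀) (Ne.symm hB₀))⟩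
  rw [← Finset.sum_mul, (hq.iid M).2, one_mul, havg] at hlt
  exact absurd hbound (not_le.2 hlt)

theorem sum_iid_succ [Fintype α] (P : α → ℝ) (n : ℕ) (F : (Fin (n + 1) → α) → ℝ) :
    ∑ z, iid P (n + 1) z * F z =
      ∑ a, ∑ z, P a * iid P n z * F (Fin.cons a z) := by
  rw [← Fintype.sum_prod_type', ← (Fin.consEquiv fun _ => α).sum_comp]
  refine Finset.sum_congr rfl fun z _ => ?_
  simp [iid, Fin.prod_univ_succ, Fin.consEquiv]

theorem sum_iid_mul_sum_eq_zero [Fintype α] {P : α → ℝ} (hP : IsPMF P) {f : α → ℝ}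
    (hf : ∑ a, P a * f a = 0) (n : ℕ) :
    ∑ z : Fin n → α, iid P n z * ∑ i, f (z i) = 0 := by
  induction n with
  | zero => simp
  | succ n ih =>
    rw [sum_iid_succ]
    have h : ∀ a, ∑ z : Fin n → α,
        P a * iid P n z * ∑ i, f ((Fin.cons a z : Fin (n + 1) → α) i) = P a * f a := by
      intro a
      have : ∀ z : Fin n → α,
          P a * iid P n z * ∑ i, f ((Fin.cons a z : Fin (n + 1) → α) i) =
          P a * f a * iid P n z + P a * (iid P n z * ∑ i, f (z i)) := by
        intro z
        rw [Fin.sum_univ_succ]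
        simp only [Fin.cons_zero, Fin.cons_succ]
        ring
      simp_rw [this, Finset.sum_add_distrib, ← Finset.mul_sum, (hP.iid n).2, ih]
      ring
    simp_rw [h, hf]

theorem sum_iid_mul_sum_sq [Fintype α] {P : α → ℝ} (hP : IsPMF P) {f : α → ℝ}
    (hf : ∑ a, P a * f a = 0) (n : ℕ) :
    ∑ z : Fin n → α, iid P n z * (∑ i, f (z i)) ^ 2 = n * ∑ a, P a * f a ^ 2 := by
  induction n with
  | zero => simp
  | succ n ih =>
    rw [sum_iid_succ]
    have h : ∀ a, ∑ z : Fin n → α,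
        P a * iid P n z * (∑ i, f ((Fin.cons a z : Fin (n + 1) → α) i)) ^ 2 =
        P a * f a ^ 2 + P a * (n * ∑ a, P a * f a ^ 2) := by
      intro a
      have : ∀ z : Fin n → α,
          P a * iid P n z * (∑ i, f ((Fin.cons a z : Fin (n + 1) → α) i)) ^ 2 =
          P a * f a ^ 2 * iid P n z + 2 * P a * f a * (iid P n z * ∑ i, f (z i)) +
            P a * (iid P n z * (∑ i, f (z i)) ^ 2) := by
        intro z
        rw [Fin.sum_univ_succ]
        simp only [Fin.cons_zero, Fin.cons_succ]
        ring
      simp_rw [this, Finset.sum_add_distrib]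
      rw [← Finset.mul_sum, ← Finset.mul_sum, ← Finset.mul_sum, (hP.iid n).2, ih,
        sum_iid_mul_sum_eq_zero hP hf]
      ring
    simp_rw [h, Finset.sum_add_distrib, ← Finset.sum_mul, hP.2]
    push_cast
    ring

/-- Weak law of large numbers for the frequency of one letter. -/
theorem sum_iid_freq_deviation_le [Fintype α] [DecidableEq α] {P : α → ℝ} (hP : IsPMF P)
    {n : ℕ} (hn : 0 < n) {ε : ℝ} (hε : 0 < ε) (a : α) :
    ∑ z : Fin n → α, iid P n z *
      (if |((Finset.univ.filter fun i => z i = a).card : ℝ) / n - P a| ≤ ε then 0 else 1) ≤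
      1 / (n * ε ^ 2) := by
  have hn' : (0 : ℝ) < n := Nat.cast_pos.2 hn
  set f : α → ℝ := fun b => (if b = a then 1 else 0) - P a with hfdef
  have hf : ∑ b, P b * f b = 0 := by
    simp [hfdef, mul_sub, Finset.sum_sub_distrib, ← Finset.sum_mul, hP.2]
  have hvar : ∑ b, P b * f b ^ 2 ≤ 1 := by
    rw [← hP.2]
    refine Finset.sum_le_sum fun b _ => mul_le_of_le_one_right (hP.1 b) ?_
    have h0 := hP.1 a
    have h1 := hP.le_one a
    simp only [hfdef]
    split_ifs <;> nlinarith
  have hsum : ∀ z : Fin n → α, ∑ i, f (z i) =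
      n * (((Finset.univ.filter fun i => z i = a).card : ℝ) / n - P a) := by
    intro z
    simp only [hfdef, Finset.sum_sub_distrib, Finset.sum_boole, Finset.sum_const,
      Finset.card_univ, Fintype.card_fin, nsmul_eq_mul]
    field_simp
  calc _ ≤ ∑ z : Fin n → α, iid P n z * (∑ i, f (z i)) ^ 2 * (1 / (n * ε) ^ 2) := by
        refine Finset.sum_le_sum fun z _ => ?_
        rw [mul_assoc]
        refine mul_le_mul_of_nonneg_left ?_ ((hP.iid n).1 z)
        split_ifs with h
        · positivity
        · rw [hsum, mul_one_div, le_div_iff₀ (by positivity), one_mul, sq_le_sq, abs_mul,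
            abs_mul, abs_of_pos hε]
          exact mul_le_mul_of_nonneg_left (not_le.1 h).le (abs_nonneg _)
    _ = n * (∑ b, P b * f b ^ 2) * (1 / (n * ε) ^ 2) := by
        rw [← Finset.sum_mul, sum_iid_mul_sum_sq hP hf]
    _ ≤ n * 1 * (1 / (n * ε) ^ 2) := by gcongr
    _ = 1 / (n * ε ^ 2) := by field_simp

/-- The joint type of `(xs, ys)` is within `ε` of `P` at every pair of letters. -/
def JointlyTypical [DecidableEq X] [DecidableEq Y] (P : X × Y → ℝ) (ε : ℝ) {n : ℕ}
    (xs : Fin n → X) (ys : Fin n → Y) : Prop :=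
  ∀ p, |empDist xs ys p - P p| ≤ ε

theorem tvDist_le_of_forall_abs_sub_le [Fintype α] {P Q : α → ℝ} {ε : ℝ}
    (h : ∀ a, |P a - Q a| ≤ ε) : tvDist P Q ≤ Fintype.card α * ε := by
  refine Finset.sup'_le _ _ fun A _ => ?_
  rw [← Finset.sum_sub_distrib]
  calc |∑ a ∈ A, (P a - Q a)| ≤ ∑ a ∈ A, |P a - Q a| := Finset.abs_sum_le_sum_abs _ _
    _ ≤ ∑ a, |P a - Q a| :=
        Finset.sum_le_univ_sum_of_nonneg fun _ => abs_nonneg _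
    _ ≤ ∑ _a : α, ε := Finset.sum_le_sum fun a _ => h a
    _ = Fintype.card α * ε := by simp

theorem abs_empDist_sub_le_of_eq_off [DecidableEq X] [DecidableEq Y] {n : ℕ}
    (xs : Fin n → X) {ys ys' : Fin n → Y} (j : Fin n)
    (h : ∀ i, i ≠ j → ys i = ys' i) (p : X × Y) :
    |empDist xs ys p - empDist xs ys' p| ≤ 1 / n := by
  rw [empDist, empDist, ← sub_div, abs_div, Nat.abs_cast]
  refine div_le_div_of_nonneg_right ?_ (Nat.cast_nonneg n)
  simp_rw [← Finset.sum_boole]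
  rw [← Finset.sum_sub_distrib, Finset.sum_eq_single j]
  · split_ifs <;> simp
  · intro i _ hij
    rw [h i hij, sub_self]
  · simp

theorem margX_eq [Fintype Y] {PX : X → ℝ} {W : X → Y → ℝ} {P : X × Y → ℝ}
    (hW : ∀ x, IsPMF (W x)) (hP : ∀ x y, P (x, y) = PX x * W x y) :
    margX P = PX := by
  funext x
  simp_rw [margX, hP, ← Finset.mul_sum, (hW x).2, mul_one]

section Joint

variable [Fintype X] [Fintype Y] {PX : X → ℝ} {W : X → Y → ℝ} {P : X × Y → ℝ}

theorem isPMF_joint (hPX : IsPMF PX) (hW : ∀ x, IsPMF (W x))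
    (hP : ∀ x y, P (x, y) = PX x * W x y) : IsPMF P := by
  refine ⟨fun ⟨x, y⟩ => hP x y ▸ mul_nonneg (hPX.1 x) ((hW x).1 y), ?_⟩
  simp_rw [Fintype.sum_prod_type, hP, ← Finset.mul_sum, (hW _).2, mul_one, hPX.2]

theorem isPMF_margY (hP : IsPMF P) : IsPMF (margY P) := by
  refine ⟨fun y => Finset.sum_nonneg fun x _ => hP.1 _, ?_⟩
  rw [← hP.2, Fintype.sum_prod_type_right]
  rfl

theorem mutualInfo_nonneg (hP : IsPMF P) : 0 ≤ mutualInfo P := by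
  have hX0 : ∀ x, 0 ≤ margX P x := fun x => Finset.sum_nonneg fun y _ => hP.1 _
  have hX1 : ∑ x, margX P x = 1 := by
    rw [← hP.2, Fintype.sum_prod_type]
    rfl
  have hY := isPMF_margY hP
  have key : ∀ x y, P (x, y) - margX P x * margY P y ≤
      P (x, y) * Real.log (P (x, y) / (margX P x * margY P y)) := by
    intro x y
    rcases (hP.1 (x, y)).eq_or_lt with h | h
    · rw [← h]
      have := mul_nonneg (hX0 x) (hY.1 y)
      simpa using this
    · have hx : 0 < margX P x := h.trans_le
        (Finset.single_le_sum (f := fun y => P (x, y)) (fun b _ => hP.1 _) (Finset.mem_univ y))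
      have hy : 0 < margY P y := h.trans_le
        (Finset.single_le_sum (f := fun x => P (x, y)) (fun b _ => hP.1 _) (Finset.mem_univ x))
      have hlog := Real.one_sub_inv_le_log_of_pos (div_pos h (mul_pos hx hy))
      refine le_trans (le_of_eq ?_) (mul_le_mul_of_nonneg_left hlog h.le)
      field_simp
  have hsum := Finset.sum_le_sum fun x (_ : x ∈ Finset.univ) =>
    Finset.sum_le_sum fun y (_ : y ∈ Finset.univ) => key x y
  simp_rw [Finset.sum_sub_distrib, ← Finset.mul_sum, hY.2, mul_one, hX1] at hsum
  rw [← Fintype.sum_prod_type', hP.2, sub_self] at hsum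
  exact hsum

/-- Information density `log (P(x,y) / (P_X(x) P_Y(y)))`. -/
noncomputable def infoDensity (P : X × Y → ℝ) (p : X × Y) : ℝ :=
  Real.log (P p / (margX P p.1 * margY P p.2))

theorem channel_le_margY_mul_exp (hPXfull : ∀ x, 0 < PX x) (hPX : IsPMF PX)
    (hW : ∀ x, IsPMF (W x)) (hP : ∀ x y, P (x, y) = PX x * W x y) (x : X) (y : Y) :
    W x y ≤ margY P y * Real.exp (infoDensity P (x, y)) := by
  have hPmf := isPMF_joint hPX hW hP
  rcases ((hW x).1 y).eq_or_lt with h | h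
  · rw [← h]
    exact mul_nonneg ((isPMF_margY hPmf).1 y) (Real.exp_pos _).le
  · have hpos : 0 < P (x, y) := hP x y ▸ mul_pos (hPXfull x) h
    have hy : 0 < margY P y := hpos.trans_le
      (Finset.single_le_sum (f := fun x => P (x, y)) (fun b _ => hPmf.1 _) (Finset.mem_univ x))
    have hx := hPXfull x
    rw [infoDensity, margX_eq hW hP, Real.exp_log (by positivity), hP]
    apply le_of_eq
    field_simp

variable [DecidableEq X] [DecidableEq Y]

theorem sum_eq_mul_sum_empDist {n : ℕ} (hn : 0 < n) (xs : Fin n → X) (ys : Fin n → Y)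
    (f : X × Y → ℝ) : ∑ i, f (xs i, ys i) = n * ∑ p, empDist xs ys p * f p := by
  have hn' : (n : ℝ) ≠ 0 := Nat.cast_ne_zero.2 hn.ne'
  have h : ∀ p, (n : ℝ) * (empDist xs ys p * f p) =
      ∑ i, if (xs i, ys i) = p then f p else 0 := by
    intro p
    rw [← Finset.sum_filter, Finset.sum_const, nsmul_eq_mul, empDist]
    simp only [Prod.ext_iff]
    field_simp
  rw [Finset.mul_sum]
  simp_rw [h]
  rw [Finset.sum_comm]
  simp

theorem JointlyTypical.sum_infoDensity_le {n : ℕ} (hn : 0 < n) {ε : ℝ} {xs : Fin n → X}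
    {ys : Fin n → Y} (h : JointlyTypical P ε xs ys) :
    ∑ i, infoDensity P (xs i, ys i) ≤
      n * (mutualInfo P + (∑ p, |infoDensity P p|) * ε) := by
  rw [sum_eq_mul_sum_empDist hn]
  refine mul_le_mul_of_nonneg_left ?_ (Nat.cast_nonneg n)
  have hI : mutualInfo P = ∑ p, P p * infoDensity P p := by
    rw [Fintype.sum_prod_type]
    rfl
  rw [hI, Finset.sum_mul, ← Finset.sum_add_distrib]
  refine Finset.sum_le_sum fun p _ => ?_
  have h1 : (empDist xs ys p - P p) * infoDensity P p ≤ |infoDensity P p| * ε := by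
    refine (le_abs_self _).trans ?_
    rw [abs_mul, mul_comm]
    exact mul_le_mul_of_nonneg_left (h p) (abs_nonneg _)
  linarith

theorem JointlyTypical.exp_mul_channel_le (hPXfull : ∀ x, 0 < PX x) (hPX : IsPMF PX)
    (hW : ∀ x, IsPMF (W x)) (hP : ∀ x y, P (x, y) = PX x * W x y) {n : ℕ} (hn : 0 < n) {ε : ℝ}
    {xs : Fin n → X} {ys : Fin n → Y} (h : JointlyTypical P ε xs ys) :
    Real.exp (-(n * (mutualInfo P + (∑ p, |infoDensity P p|) * ε))) *
      ∏ i, W (xs i) (ys i) ≤ iid (margY P) n ys := by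
  have hY := isPMF_margY (isPMF_joint hPX hW hP)
  have h1 : ∏ i, W (xs i) (ys i) ≤
      iid (margY P) n ys * Real.exp (∑ i, infoDensity P (xs i, ys i)) := by
    rw [Real.exp_sum, iid, ← Finset.prod_mul_distrib]
    exact Finset.prod_le_prod (fun i _ => (hW _).1 _)
      fun i _ => channel_le_margY_mul_exp hPXfull hPX hW hP _ _
  have h2 := h1.trans (mul_le_mul_of_nonneg_left
    (Real.exp_le_exp.2 (h.sum_infoDensity_le hn)) ((hY.iid n).1 ys))
  rw [Real.exp_neg, inv_mul_le_iff₀ (Real.exp_pos _), mul_comm]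
  exact h2

theorem sum_not_jointlyTypical_le (hPX : IsPMF PX)
    (hW : ∀ x, IsPMF (W x)) (hP : ∀ x y, P (x, y) = PX x * W x y) {n : ℕ} (hn : 0 < n) {ε : ℝ}
    (hε : 0 < ε) :
    ∑ xs : Fin n → X, iid PX n xs * ∑ ys : Fin n → Y, (∏ i, W (xs i) (ys i)) *
      (if JointlyTypical P ε xs ys then 0 else 1) ≤
      Fintype.card (X × Y) * (1 / (n * ε ^ 2)) := by
  have hPmf := isPMF_joint hPX hW hP
  have hunion : ∀ z : Fin n → X × Y,
      (if JointlyTypical P ε (fun i => (z i).1) (fun i => (z i).2) then (0 : ℝ) else 1) ≤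
      ∑ p, if |((Finset.univ.filter fun i => z i = p).card : ℝ) / n - P p| ≤ ε
        then 0 else 1 := by
    intro z
    have hnn : ∀ p, (0 : ℝ) ≤
        if |((Finset.univ.filter fun i => z i = p).card : ℝ) / n - P p| ≤ ε then 0 else 1 := by
      intro p
      split_ifs <;> simp
    split_ifs with h
    · exact Finset.sum_nonneg fun p _ => hnn p
    · rw [JointlyTypical] at h
      push Not at h
      obtain ⟨p, hp⟩ := h
      refine le_trans (le_of_eq ?_)
        (Finset.single_le_sum (fun p _ => hnn p) (Finset.mem_univ p))
      rw [if_neg]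
      simpa [empDist, Prod.ext_iff] using hp
  calc _ = ∑ z : Fin n → X × Y, iid P n z *
        (if JointlyTypical P ε (fun i => (z i).1) (fun i => (z i).2) then 0 else 1) := by
        rw [← (Equiv.arrowProdEquivProdArrow (Fin n) (fun _ => X) (fun _ => Y)).symm.sum_comp,
          Fintype.sum_prod_type]
        refine Finset.sum_congr rfl fun xs _ => ?_
        rw [Finset.mul_sum]
        refine Finset.sum_congr rfl fun ys _ => ?_
        simp only [Equiv.arrowProdEquivProdArrow, Equiv.coe_fn_symm_mk, iid, hP,
          Finset.prod_mul_distrib]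
        exact (mul_assoc _ _ _).symm
    _ ≤ ∑ z : Fin n → X × Y, iid P n z *
        ∑ p, (if |((Finset.univ.filter fun i => z i = p).card : ℝ) / n - P p| ≤ ε
          then 0 else 1) :=
        Finset.sum_le_sum fun z _ =>
          mul_le_mul_of_nonneg_left (hunion z) ((hPmf.iid n).1 z)
    _ = ∑ p, ∑ z : Fin n → X × Y, iid P n z *
        (if |((Finset.univ.filter fun i => z i = p).card : ℝ) / n - P p| ≤ ε
          then 0 else 1) := by
        simp_rw [Finset.mul_sum]
        rw [Finset.sum_comm]
    _ ≤ ∑ _p : X × Y, 1 / (n * ε ^ 2) :=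
        Finset.sum_le_sum fun p _ => sum_iid_freq_deviation_le hPmf hn hε p
    _ = _ := by rw [Finset.sum_const, Finset.card_univ, nsmul_eq_mul]

/-- A code that covers typical sources and whose codewords all start with the letter `y₀`. -/
theorem exists_code_covering (hPXfull : ∀ x, 0 < PX x) (hPX : IsPMF PX)
    (hW : ∀ x, IsPMF (W x)) (hP : ∀ x y, P (x, y) = PX x * W x y) (y₀ : Y) {n : ℕ} (hn : 0 < n)
    {ε : ℝ} (hε : 0 < ε) {M : ℕ} (hM : 0 < M) :
    ∃ c : Code X Y n, c.M = M ∧ (∀ m, c.dec m ⟨0, hn⟩ = y₀) ∧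
      ∑ xs, iid PX n xs * (if JointlyTypical P (ε + 1 / n) xs (c.out xs) then 0 else 1) ≤
        Fintype.card (X × Y) * (1 / (n * ε ^ 2)) +
        Real.exp (-(Real.exp (-(n * (mutualInfo P + (∑ p, |infoDensity P p|) * ε))) * M)) := by
  have hPmf := isPMF_joint hPX hW hP
  have hV : ∀ xs : Fin n → X, IsPMF fun ys : Fin n → Y => ∏ i, W (xs i) (ys i) := by
    intro xs
    refine ⟨fun ys => Finset.prod_nonneg fun i _ => (hW _).1 _, ?_⟩
    have := Finset.prod_univ_sum (fun _ : Fin n => (Finset.univ : Finset Y))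
      fun i y => W (xs i) y
    simpa [(hW _).2] using this.symm
  obtain ⟨B, hB⟩ := exists_codebook_covering (hPX.iid n) hV ((isPMF_margY hPmf).iid n)
    (JointlyTypical P ε) (fun xs ys h => h.exp_mul_channel_le hPXfull hPX hW hP hn) M
  refine ⟨⟨M, hM, fun xs => if h : ∃ m, JointlyTypical P ε xs (B m) then h.choose else ⟨0, hM⟩,
    fun m i => if i = ⟨0, hn⟩ then y₀ else B m i⟩, rfl, fun m => by simp, ?_⟩
  refine le_trans (Finset.sum_le_sum fun xs _ =>
    mul_le_mul_of_nonneg_left ?_ ((hPX.iid n).1 xs))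
    (hB.trans (add_le_add (sum_not_jointlyTypical_le hPX hW hP hn hε) le_rfl))
  by_cases h : ∃ m, JointlyTypical P ε xs (B m)
  · rw [if_pos h, if_pos]
    intro p
    simp only [Code.out, dif_pos h]
    have h1 := h.choose_spec p
    have h2 := abs_empDist_sub_le_of_eq_off xs (ys := fun i => if i = ⟨0, hn⟩ then y₀ else
      B h.choose i) (ys' := B h.choose) ⟨0, hn⟩ (fun i hi => if_neg hi) p
    have h3 := abs_sub_le (empDist xs (fun i => if i = ⟨0, hn⟩ then y₀ else B h.choose i) p)
      (empDist xs (B h.choose) p) (P p)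
    linarith
  · rw [if_neg h]
    split_ifs <;> simp

theorem exists_goodCoord_dec_zero_eq (hPXfull : ∀ x, 0 < PX x) (hPX : IsPMF PX)
    (hW : ∀ x, IsPMF (W x)) (hP : ∀ x y, P (x, y) = PX x * W x y) (y₀ : Y) :
    ∃ c : ∀ n, Code X Y n, GoodCoord PX P c ∧
      ∀ n (hn : 0 < n) m, (c n).dec m ⟨0, hn⟩ = y₀ := by
  have hI := mutualInfo_nonneg (isPMF_joint hPX hW hP)
  set C := ∑ p, |infoDensity P p| with hC
  have hC0 : 0 ≤ C := Finset.sum_nonneg fun _ _ => abs_nonneg _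
  set ε : ℕ → ℝ := fun n => (√(√n))⁻¹ with hεdef
  set E : ℕ → ℝ := fun n => mutualInfo P + C * ε n + ε n with hEdef
  have hεnn : ∀ n, 0 ≤ ε n := fun n => by positivity
  have hE0 : ∀ n, 0 ≤ E n := fun n => by
    have := hεnn n
    positivity
  have hsq : Tendsto (fun n : ℕ => √(n : ℝ)) atTop atTop :=
    Real.tendsto_sqrt_atTop.comp tendsto_natCast_atTop_atTop
  have hε0 : Tendsto ε atTop (nhds 0) :=
    (Real.tendsto_sqrt_atTop.comp hsq).inv_tendsto_atTop
  have hεpos : ∀ n, 0 < n → 0 < ε n := fun n hn => by positivity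
  have hnε2 : ∀ n : ℕ, n * ε n ^ 2 = √n := fun n => by
    rw [hεdef]
    dsimp only
    rw [inv_pow, Real.sq_sqrt (Real.sqrt_nonneg _), ← div_eq_mul_inv, Real.div_sqrt]
  have hnε : Tendsto (fun n => n * ε n) atTop atTop := by
    refine tendsto_atTop_mono' _ ?_ hsq
    filter_upwards [hε0.eventually_le_const zero_lt_one] with n hn
    rw [← hnε2]
    have := hεnn n
    gcongr
    nlinarith
  set M : ℕ → ℕ := fun n => ⌈Real.exp (n * E n)⌉₊ with hMdef
  have hM : ∀ n, 0 < M n := fun n => Nat.ceil_pos.2 (Real.exp_pos _)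
  have hex : ∀ n, ∃ c : Code X Y n, c.M = M n ∧ ∀ hn : 0 < n,
      (∀ m, c.dec m ⟨0, hn⟩ = y₀) ∧
      ∑ xs, iid PX n xs * (if JointlyTypical P (ε n + 1 / n) xs (c.out xs) then 0 else 1) ≤
        Fintype.card (X × Y) * (1 / (n * ε n ^ 2)) +
        Real.exp (-(Real.exp (-(n * (mutualInfo P + C * ε n))) * M n)) := by
    intro n
    rcases n.eq_zero_or_pos with rfl | hn
    · exact ⟨⟨M 0, hM 0, fun _ => ⟨0, hM 0⟩, fun _ _ => y₀⟩, rfl,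
        fun hn => absurd hn (lt_irrefl 0)⟩
    · obtain ⟨c, h1, h2, h3⟩ :=
        exists_code_covering hPXfull hPX hW hP y₀ hn (hεpos n hn) (hM n)
      exact ⟨c, h1, fun _ => ⟨h2, h3⟩⟩
  choose c hcM hc using hex
  have hrate : Tendsto (fun n => (c n).rate) atTop (nhds (mutualInfo P)) := by
    have hlo : Tendsto E atTop (nhds (mutualInfo P)) := by
      simpa [hEdef] using ((hε0.const_mul C).const_add (mutualInfo P)).add hε0
    have hhi : Tendsto (fun n : ℕ => Real.log 2 / n + E n) atTop (nhds (mutualInfo P)) := by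
      simpa using (tendsto_const_div_atTop_nhds_zero_nat (Real.log 2)).add hlo
    refine tendsto_of_tendsto_of_tendsto_of_le_of_le' hlo hhi ?_ ?_
    · filter_upwards [eventually_gt_atTop 0] with n hn
      have hn' : (0 : ℝ) < n := Nat.cast_pos.2 hn
      rw [Code.rate, hcM, le_div_iff₀ hn', Real.le_log_iff_exp_le (Nat.cast_pos.2 (hM n)),
        mul_comm]
      exact Nat.le_ceil _
    · filter_upwards [eventually_gt_atTop 0] with n hn
      have hn' : (0 : ℝ) < n := Nat.cast_pos.2 hn
      have h1 : (1 : ℝ) ≤ Real.exp (n * E n) :=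
        Real.one_le_exp (mul_nonneg hn'.le (hE0 n))
      have h2 : (M n : ℝ) ≤ 2 * Real.exp (n * E n) := by
        have := (Nat.ceil_lt_add_one (Real.exp_pos (n * E n)).le).le
        simp only [hMdef]
        linarith
      have h3 := Real.log_le_log (Nat.cast_pos.2 (hM n)) h2
      rw [Real.log_mul two_ne_zero (Real.exp_pos _).ne', Real.log_exp] at h3
      rw [Code.rate, hcM, div_le_iff₀ hn', add_mul, div_mul_cancel₀ _ hn'.ne', mul_comm (E n)]
      exact h3
  refine ⟨c, ⟨hrate, fun δ hδ => ?_⟩, fun n hn => (hc n hn).1⟩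
  have hbound : Tendsto (fun n : ℕ => Fintype.card (X × Y) * (1 / (n * ε n ^ 2)) +
      Real.exp (-(Real.exp (n * ε n)))) atTop (nhds 0) := by
    have h1 : Tendsto (fun n : ℕ => 1 / (n * ε n ^ 2)) atTop (nhds 0) := by
      simp_rw [hnε2, one_div]
      exact hsq.inv_tendsto_atTop
    have h2 : Tendsto (fun n : ℕ => Real.exp (-(Real.exp (n * ε n)))) atTop (nhds 0) :=
      Real.tendsto_exp_neg_atTop_nhds_zero.comp (Real.tendsto_exp_atTop.comp hnε)
    simpa using (h1.const_mul (Fintype.card (X × Y) : ℝ)).add h2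
  have hsmall : Tendsto (fun n : ℕ => (Fintype.card (X × Y) : ℝ) * (ε n + 1 / n)) atTop
      (nhds 0) := by
    simpa using (hε0.add (tendsto_const_div_atTop_nhds_zero_nat 1)).const_mul
      (Fintype.card (X × Y) : ℝ)
  refine tendsto_of_tendsto_of_tendsto_of_le_of_le' tendsto_const_nhds hbound ?_ ?_
  · refine Eventually.of_forall fun n => Finset.sum_nonneg fun xs _ => ?_
    have := (hPX.iid n).1 xs
    split_ifs
    exacts [this, le_rfl]
  · filter_upwards [eventually_gt_atTop 0, hsmall.eventually_le_const hδ] with n hn hnδ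
    have hM' : Real.exp (n * ε n) ≤ Real.exp (-(n * (mutualInfo P + C * ε n))) * M n := by
      refine le_trans (le_of_eq ?_)
        (mul_le_mul_of_nonneg_left (Nat.le_ceil (Real.exp (n * E n))) (Real.exp_pos _).le)
      rw [← Real.exp_add]
      congr 1
      simp only [hEdef]
      ring
    refine le_trans (Finset.sum_le_sum fun xs _ => ?_) ((hc n hn).2.trans
      (add_le_add le_rfl (Real.exp_le_exp.2 (neg_le_neg hM'))))
    by_cases h : JointlyTypical P (ε n + 1 / n) xs ((c n).out xs)
    · rw [if_pos h, if_neg (not_lt.2 ((tvDist_le_of_forall_abs_sub_le h).trans hnδ)), mul_zero]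
    · rw [if_neg h, mul_one]
      have := (hPX.iid n).1 xs
      split_ifs
      exacts [le_rfl, this]

end Joint

theorem relEnt_eq_top_of_exists [Fintype α] {P Q : α → ℝ} (h : ∃ a, Q a = 0 ∧ P a ≠ 0) :
    relEnt P Q = ⊤ := by
  obtain ⟨a, hQ, hPa⟩ := h
  exact if_neg fun hac => hPa (hac a hQ)

end CoveringCodes

/-- **Theorem 2 (second part).** If `P_{XY} ∉ 𝒜` — excluding the single pathological
case `P_{XY}(x,y) = (1/|𝒳|)·1{x=y}` (here expressed via an identification `e : X ≃ Y`
of the two alphabets) — then there exists a good sequence of coordination codes for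
`P_{Y|X}` along which the normalized relative entropy diverges to `∞`. -/
theorem exists_good_coordination_codes_relEnt_diverges
    {X Y : Type*} [Fintype X] [Fintype Y] [DecidableEq X] [DecidableEq Y]
    (PX : X → ℝ) (hPX : IsPMF PX) (hPXfull : ∀ x, 0 < PX x)
    (W : X → Y → ℝ) (hW : ∀ x, IsPMF (W x))
    (PXY : X × Y → ℝ) (hPXY : ∀ x y, PXY (x, y) = PX x * W x y)
    (hnotA : ¬ ∀ x y, 0 < condXY PXY x y)
    (hnotPath : ¬ ∃ e : X ≃ Y, ∀ x y,
      PXY (x, y) = if e x = y then ((Fintype.card X : ℝ))⁻¹ else 0) :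
    ∃ c : ∀ n, Code X Y n, GoodCoord PX PXY c ∧
      Tendsto
        (fun n => relEnt (inducedJoint PX (c n)) (approxJoint PXY (c n)) / (n : ℝ≥0∞))
        atTop (nhds ⊤) := by
  obtain ⟨x₀, y₀, hxy⟩ : ∃ x y, condXY PXY x y ≤ 0 := by
    push Not at hnotA
    exact hnotA
  have hPmf := isPMF_joint hPX hW hPXY
  have hzero : condXY PXY x₀ y₀ = 0 :=
    hxy.antisymm (div_nonneg (hPmf.1 _) ((isPMF_margY hPmf).1 y₀))
  obtain ⟨c, hgood, hdec⟩ := exists_goodCoord_dec_zero_eq hPXfull hPX hW hPXY y₀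
  refine ⟨c, hgood, tendsto_const_nhds.congr' ?_⟩
  filter_upwards [eventually_gt_atTop 0] with n hn
  rw [relEnt_eq_top_of_exists, ENNReal.top_div_of_ne_top (ENNReal.natCast_ne_top n)]
  refine ⟨(fun _ => x₀, (c n).out fun _ => x₀), ?_, ?_⟩
  · rw [approxJoint, Finset.prod_eq_zero (Finset.mem_univ (⟨0, hn⟩ : Fin n)), mul_zero]
    simp only [Code.out, hdec n hn, hzero]
  · simp [inducedJoint, (hPXfull x₀).ne']
end
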